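/- arXiv:2502.13292 — 2 statements merged into one kernel-verified Lean document; each statement's English description precedes it below -/
import Mathlib

section
/- Let D be a pseudo-distribution on {0,1}^n of degree at least 2k+2 such that Ẽ_D[X_S] = 0 for every S ⊆ [n] with k+1 ≤ |S| ≤ 2k+2. Then there exists a probability distribution μ on {0,1}^n such that E_μ[X_S] = Ẽ_D[X_S] for every S ⊆ [n] with |S| ≤ 2k+2. -/
/-- The point of `{0,1}` encoded by a boolean. -/
def b01 (b : Bool) : ℝ := if b then 1 else 0

/-- Pseudo-expectation of `f` with respect to `D` on `{0,1}^n`. -/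
def PE {n : ℕ} (D f : (Fin n → Bool) → ℝ) : ℝ := ∑ x, D x * f x

/-- The monomial `X_T(x) = ∏_{i ∈ T} x_i` on `{0,1}^n`. -/
def XS {n : ℕ} (T : Finset (Fin n)) (x : Fin n → Bool) : ℝ := ∏ i ∈ T, b01 (x i)

/-- `f : {0,1}^n → ℝ` is a (multilinear) polynomial of degree at most `d`. -/
def DegLE {n : ℕ} (d : ℕ) (f : (Fin n → Bool) → ℝ) : Prop :=
  ∃ c : Finset (Fin n) → ℝ, (∀ T : Finset (Fin n), d < T.card → c T = 0) ∧
    ∀ x, f x = ∑ T : Finset (Fin n), c T * XS T x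

/-- The coefficient of `X_U` in the multilinear expansion of the indicator function of `x`. -/
def indicatorCoeff {n : ℕ} (x : Fin n → Bool) (U : Finset (Fin n)) : ℝ :=
  (∏ i ∈ U, if x i then (1 : ℝ) else -1) * ∏ i ∈ Finset.univ \ U, if x i then (0 : ℝ) else 1

theorem sum_indicatorCoeff_mul_XS {n : ℕ} (x y : Fin n → Bool) :
    ∑ U, indicatorCoeff x U * XS U y = if x = y then 1 else 0 := by
  have h := Finset.prod_add (fun i => (if x i then (1 : ℝ) else -1) * b01 (y i))
    (fun i => if x i then (0 : ℝ) else 1) Finset.univ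
  rw [Finset.powerset_univ] at h
  have h' : ∑ U, indicatorCoeff x U * XS U y = ∏ i, if x i = y i then (1 : ℝ) else 0 := by
    calc _ = _ := Finset.sum_congr rfl fun U _ => by
          rw [indicatorCoeff, XS, mul_right_comm, ← Finset.prod_mul_distrib]
      _ = _ := h.symm
      _ = _ := Finset.prod_congr rfl fun i _ => by
          cases x i <;> cases y i <;> simp [b01]
  rw [h']
  split_ifs with hxy
  · simp [hxy]
  · obtain ⟨i, hi⟩ := Function.ne_iff.mp hxy
    exact Finset.prod_eq_zero (Finset.mem_univ i) (if_neg hi)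

theorem sum_XS_mul_indicatorCoeff {n : ℕ} (S U : Finset (Fin n)) :
    ∑ x, XS S x * indicatorCoeff x U = if S = U then 1 else 0 := by
  have h : (Matrix.of fun x U => indicatorCoeff x U : Matrix (Fin n → Bool) (Finset (Fin n)) ℝ) *
      (Matrix.of fun U y => XS U y : Matrix (Finset (Fin n)) (Fin n → Bool) ℝ) = 1 := by
    ext x y
    simp [Matrix.mul_apply, Matrix.one_apply, sum_indicatorCoeff_mul_XS]
  have h' := (Matrix.mul_eq_one_comm_of_card_eq _ _ _ (by simp)).mp h
  simpa [Matrix.mul_apply, Matrix.one_apply] using congrFun (congrFun h' S) U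

theorem XS_mul_XS {n : ℕ} (S T : Finset (Fin n)) (x : Fin n → Bool) :
    XS S x * XS T x = XS (S ∪ T) x := by
  have h (U : Finset (Fin n)) : XS U x = if ∀ i ∈ U, x i = true then 1 else 0 := by
    simp only [XS, b01, Finset.prod_ite_zero, Finset.prod_const_one]
  simp only [h, Finset.mem_union, or_imp, forall_and, ite_and]
  split_ifs <;> simp

theorem PE_sum_mul_sum {n : ℕ} (D : (Fin n → Bool) → ℝ) (a : Finset (Fin n) → ℝ) :
    PE D (fun x => (∑ U, a U * XS U x) * ∑ U, a U * XS U x) =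
      ∑ U, ∑ V, a U * a V * PE D (XS (U ∪ V)) := by
  simp only [PE, Finset.sum_mul_sum]
  simp only [Finset.mul_sum, ← XS_mul_XS]
  rw [Finset.sum_comm]
  refine Finset.sum_congr rfl fun U _ => ?_
  rw [Finset.sum_comm]
  refine Finset.sum_congr rfl fun V _ => Finset.sum_congr rfl fun x _ => ?_
  ring

/-- Every assignment of moments is realised by a signed measure on the cube. -/
theorem PE_sum_indicatorCoeff {n : ℕ} (m : Finset (Fin n) → ℝ) (S : Finset (Fin n)) :
    PE (fun x => ∑ U, indicatorCoeff x U * m U) (XS S) = m S := by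
  simp only [PE, Finset.sum_mul]
  rw [Finset.sum_comm]
  calc _ = ∑ U, (∑ x, XS S x * indicatorCoeff x U) * m U :=
        Finset.sum_congr rfl fun U _ => by
          rw [Finset.sum_mul]
          exact Finset.sum_congr rfl fun x _ => by ring
    _ = m S := by simp [sum_XS_mul_indicatorCoeff]

/-- Global distributions: if `D` is a pseudo-distribution of degree
at least `2k+2` on `{0,1}^n` with `Ẽ_D[X_S] = 0` for all `S` with
`k+1 ≤ |S| ≤ 2k+2`, then there is a genuine probability distribution `μ` on
`{0,1}^n` agreeing with `D` on all moments of degree at most `2k+2`. -/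
theorem global_distribution (n k : ℕ) (D : (Fin n → Bool) → ℝ)
    (hsum : ∑ x, D x = 1)
    (hdeg : ∀ f : (Fin n → Bool) → ℝ, DegLE (k + 1) f → 0 ≤ PE D (fun x => f x * f x))
    (hvanish : ∀ S : Finset (Fin n), k + 1 ≤ S.card → S.card ≤ 2 * k + 2 →
      PE D (XS S) = 0) :
    ∃ μ : (Fin n → Bool) → ℝ, (∀ x, 0 ≤ μ x) ∧ (∑ x, μ x = 1) ∧
      ∀ S : Finset (Fin n), S.card ≤ 2 * k + 2 → (∑ x, μ x * XS S x) = PE D (XS S) := by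
  set m : Finset (Fin n) → ℝ := fun S => if S.card ≤ k then PE D (XS S) else 0 with hm
  have hmD (S : Finset (Fin n)) (hS : S.card ≤ 2 * k + 2) : m S = PE D (XS S) := by
    simp only [hm]
    split_ifs with h
    · rfl
    · exact (hvanish S (by omega) hS).symm
  set μ : (Fin n → Bool) → ℝ := fun x => ∑ U, indicatorCoeff x U * m U with hμ
  have hmom (S : Finset (Fin n)) : PE μ (XS S) = m S := PE_sum_indicatorCoeff m S
  refine ⟨μ, fun x => ?_, ?_, fun S hS => (hmom S).trans (hmD S hS)⟩
  · set c : Finset (Fin n) → ℝ := fun U => if U.card ≤ k then indicatorCoeff x U else 0 with hc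
    have hpos := hdeg (fun y => ∑ U, c U * XS U y)
      ⟨c, fun T hT => if_neg (by omega), fun _ => rfl⟩
    have hx : μ x = PE μ (fun y => (∑ U, indicatorCoeff x U * XS U y) *
        ∑ U, indicatorCoeff x U * XS U y) := by
      simp [PE, sum_indicatorCoeff_mul_XS]
    rw [PE_sum_mul_sum] at hpos hx
    rw [hx]
    refine hpos.trans_eq (Finset.sum_congr rfl fun U _ => Finset.sum_congr rfl fun V _ => ?_)
    rw [hmom]
    by_cases hUV : U.card ≤ k ∧ V.card ≤ k
    · have hcard := Finset.card_union_le U V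
      rw [hmD _ (by omega)]
      simp [hc, hUV.1, hUV.2]
    · have hU := Finset.card_le_card (Finset.subset_union_left (s₁ := U) (s₂ := V))
      have hV := Finset.card_le_card (Finset.subset_union_right (s₁ := U) (s₂ := V))
      have hmUV : m (U ∪ V) = 0 := if_neg (by omega)
      rcases not_and_or.mp hUV with h | h <;> simp [hc, h, hmUV]
  · have h := (hmom ∅).trans (hmD ∅ (by simp))
    simpa [PE, XS, hsum] using h
end

section
/- Consider a knapsack instance with n items, capacities c_1, …, c_n ≥ 0, values v_1, …, v_n ≥ 0, and budget C ≥ 0, and let OPT = max { ∑_{i=1}^n v_i x_i : x ∈ {0,1}^n, ∑_{i=1}^n c_i x_i ≤ C }. Let t ≥ 2. Then for every pseudo-distribution D on {0,1}^n of degree at least 2t satisfying the constraint ∑_{i=1}^n c_i x_i ≤ C, it holds that Ẽ_D[∑_{i=1}^n v_i x_i] ≤ (1 + 1/(t−1))·OPT. -/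
section Monomials

variable {n : ℕ}

lemma XS_eq_ite (T : Finset (Fin n)) (x : Fin n → Bool) :
    XS T x = if T ⊆ Finset.univ.filter (fun i => x i = true) then 1 else 0 := by
  unfold XS b01
  split_ifs with h
  · exact Finset.prod_eq_one fun i hi => if_pos (by simpa using h hi)
  · obtain ⟨i, hi, hx⟩ := Finset.not_subset.mp h
    exact Finset.prod_eq_zero hi (if_neg (by simpa using hx))

lemma XS_mul (A B : Finset (Fin n)) (x : Fin n → Bool) :
    XS A x * XS B x = XS (A ∪ B) x := by
  simp only [XS_eq_ite, Finset.union_subset_iff]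
  split_ifs <;> simp_all

lemma XS_singleton (i : Fin n) (x : Fin n → Bool) : XS {i} x = b01 (x i) := by
  simp [XS]

lemma XS_mul_self (A : Finset (Fin n)) (x : Fin n → Bool) : XS A x * XS A x = XS A x := by
  rw [XS_mul, Finset.union_self]

end Monomials

namespace DegLE

variable {n d e : ℕ} {f g : (Fin n → Bool) → ℝ}

lemma monomial {T : Finset (Fin n)} (hT : T.card ≤ d) : DegLE d (XS T) := by
  refine ⟨fun U => if U = T then 1 else 0, fun U hU => if_neg ?_, fun x => by simp⟩
  rintro rfl
  omega

lemma const_mul (a : ℝ) (hf : DegLE d f) : DegLE d (fun x => a * f x) := by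
  obtain ⟨c, hc, h⟩ := hf
  refine ⟨fun T => a * c T, fun T hT => by simp [hc T hT], fun x => ?_⟩
  simp only [h x, Finset.mul_sum, mul_assoc]

lemma sum {ι : Type*} (s : Finset ι) {F : ι → (Fin n → Bool) → ℝ}
    (hF : ∀ a ∈ s, DegLE d (F a)) : DegLE d (fun x => ∑ a ∈ s, F a x) := by
  classical
  choose! c hc h using hF
  refine ⟨fun T => ∑ a ∈ s, c a T,
    fun T hT => Finset.sum_eq_zero fun a ha => hc a ha T hT, fun x => ?_⟩
  simp only [Finset.sum_mul]
  rw [Finset.sum_comm]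
  exact Finset.sum_congr rfl fun a ha => h a ha x

lemma add (hf : DegLE d f) (hg : DegLE d g) : DegLE d (fun x => f x + g x) := by
  obtain ⟨a, ha, hf⟩ := hf
  obtain ⟨b, hb, hg⟩ := hg
  exact ⟨fun T => a T + b T, fun T hT => by simp [ha T hT, hb T hT],
    fun x => by simp only [hf, hg, add_mul, Finset.sum_add_distrib]⟩

lemma sub (hf : DegLE d f) (hg : DegLE d g) : DegLE d (fun x => f x - g x) := by
  simpa [sub_eq_add_neg] using hf.add (hg.const_mul (-1))

lemma mono (hf : DegLE d f) (hde : d ≤ e) : DegLE e f := by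
  obtain ⟨c, hc, h⟩ := hf
  exact ⟨c, fun T hT => hc T (by omega), h⟩

lemma one : DegLE d (fun _ : Fin n → Bool => (1 : ℝ)) := by
  have h : XS (∅ : Finset (Fin n)) = fun _ => 1 := funext fun x => by simp [XS]
  exact h ▸ monomial (by simp)

lemma mul (hf : DegLE d f) (hg : DegLE e g) : DegLE (d + e) (fun x => f x * g x) := by
  obtain ⟨a, ha, hf⟩ := hf
  obtain ⟨b, hb, hg⟩ := hg
  have hfg : (fun x => f x * g x) =
      fun x => ∑ A : Finset (Fin n), ∑ B : Finset (Fin n), a A * b B * XS (A ∪ B) x := by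
    funext x
    simp only [hf, hg, Finset.sum_mul_sum, ← XS_mul]
    exact Finset.sum_congr rfl fun A _ => Finset.sum_congr rfl fun B _ => by ring
  rw [hfg]
  refine sum _ fun A _ => sum _ fun B _ => ?_
  by_cases hA : d < A.card
  · simpa [ha A hA] using (one (n := n) (d := d + e)).const_mul 0
  by_cases hB : e < B.card
  · simpa [hb B hB] using (one (n := n) (d := d + e)).const_mul 0
  · exact (monomial (by have := Finset.card_union_le A B; omega)).const_mul _

lemma coordinate (i : Fin n) : DegLE 1 (fun x : Fin n → Bool => b01 (x i)) := by
  have h : XS {i} = fun x : Fin n → Bool => b01 (x i) := funext (XS_singleton i)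
  exact h ▸ monomial (by simp)

end DegLE

section PseudoExpectation

variable {n : ℕ} (D : (Fin n → Bool) → ℝ)

lemma PE_add (f g : (Fin n → Bool) → ℝ) : PE D (fun x => f x + g x) = PE D f + PE D g := by
  simp [PE, mul_add, Finset.sum_add_distrib]

lemma PE_sub (f g : (Fin n → Bool) → ℝ) : PE D (fun x => f x - g x) = PE D f - PE D g := by
  simp [PE, mul_sub, Finset.sum_sub_distrib]

lemma PE_const_mul (a : ℝ) (f : (Fin n → Bool) → ℝ) :
    PE D (fun x => a * f x) = a * PE D f := by
  simp only [PE, Finset.mul_sum]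
  exact Finset.sum_congr rfl fun x _ => by ring

lemma PE_sum {ι : Type*} (s : Finset ι) (F : ι → (Fin n → Bool) → ℝ) :
    PE D (fun x => ∑ a ∈ s, F a x) = ∑ a ∈ s, PE D (F a) := by
  simp only [PE, Finset.mul_sum]
  exact Finset.sum_comm

variable {D}

lemma PE_XS_nonneg {t : ℕ}
    (hdeg : ∀ f : (Fin n → Bool) → ℝ, DegLE t f → 0 ≤ PE D (fun x => f x * f x))
    {T : Finset (Fin n)} (hT : T.card ≤ t) : 0 ≤ PE D (XS T) := by
  simpa only [XS_mul_self] using hdeg _ (DegLE.monomial hT)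

/-- A monomial containing the variables of a null monomial is null, by Cauchy–Schwarz. -/
lemma PE_XS_union_eq_zero {t : ℕ}
    (hdeg : ∀ f : (Fin n → Bool) → ℝ, DegLE t f → 0 ≤ PE D (fun x => f x * f x))
    {A B : Finset (Fin n)} (hA : A.card ≤ t) (hB : B.card ≤ t) (h0 : PE D (XS A) = 0) :
    PE D (XS (A ∪ B)) = 0 := by
  have key : ∀ s : ℝ, 0 ≤ PE D (XS B) + 2 * s * PE D (XS (A ∪ B)) := by
    intro s
    have h := hdeg _ ((DegLE.monomial hB).add ((DegLE.monomial hA).const_mul s))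
    have e : (fun x => (XS B x + s * XS A x) * (XS B x + s * XS A x)) =
        fun x => (XS B x + 2 * s * XS (A ∪ B) x) + s * s * XS A x := by
      funext x
      rw [← XS_mul A B]
      linear_combination XS_mul_self B x + s * s * XS_mul_self A x
    rw [e, PE_add, PE_add, PE_const_mul, PE_const_mul, h0] at h
    linarith
  by_contra hne
  have h := key (-(PE D (XS B) + 1) / (2 * PE D (XS (A ∪ B))))
  have e : 2 * (-(PE D (XS B) + 1) / (2 * PE D (XS (A ∪ B)))) * PE D (XS (A ∪ B)) =
      -(PE D (XS B) + 1) := by field_simp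
  linarith

end PseudoExpectation

section LowWeight

variable {n : ℕ}

/-- Coefficients of a polynomial vanishing on all points with at most `m` ones in `S`. -/
lemma coeff_eq_zero_of_vanishing {S : Finset (Fin n)} {m : ℕ} {c : Finset (Fin n) → ℝ}
    (h : ∀ x : Fin n → Bool, (S.filter (fun i => x i = true)).card ≤ m →
      ∑ T : Finset (Fin n), c T * XS T x = 0)
    (U : Finset (Fin n)) (hU : (S ∩ U).card ≤ m) : c U = 0 := by
  induction U using Finset.strongInduction with
  | H U ih =>
    have hx := h (fun i => decide (i ∈ U))
      (by simpa [Finset.filter_mem_eq_inter] using hU)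
    rw [Finset.sum_eq_single U] at hx
    · simpa [XS_eq_ite] using hx
    · intro T _ hTU
      by_cases hT : T ⊆ U
      · rw [ih T (hT.ssubset_of_ne hTU)
          ((Finset.card_le_card (Finset.inter_subset_inter_left hT)).trans hU), zero_mul]
      · simp [XS_eq_ite, hT]
    · simp

lemma PE_congr_of_low_weight {D : (Fin n → Bool) → ℝ} {S : Finset (Fin n)} {m d : ℕ}
    (hnull : ∀ U : Finset (Fin n), U.card ≤ d → m < (S ∩ U).card → PE D (XS U) = 0)
    {f g : (Fin n → Bool) → ℝ} (hf : DegLE d f) (hg : DegLE d g)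
    (hfg : ∀ x : Fin n → Bool, (S.filter (fun i => x i = true)).card ≤ m → f x = g x) :
    PE D f = PE D g := by
  rw [← sub_eq_zero, ← PE_sub]
  obtain ⟨c, hc, h⟩ := hf.sub hg
  have hc' := coeff_eq_zero_of_vanishing (S := S) (m := m) (c := c)
    fun x hx => by rw [← h, sub_eq_zero, hfg x hx]
  rw [funext h, PE_sum]
  refine Finset.sum_eq_zero fun U _ => ?_
  rw [PE_const_mul]
  by_cases hU : U.card ≤ d
  · by_cases hS : (S ∩ U).card ≤ m
    · rw [hc' U hS, zero_mul]
    · rw [hnull U hU (not_le.mp hS), mul_zero]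
  · rw [hc U (not_le.mp hU), zero_mul]

/-- The indicator of `x ∩ S = W` is a polynomial of degree at most `m` on points with at most `m`
ones in `S`. -/
lemma exists_low_degree_indicator {S W : Finset (Fin n)} (hW : W ⊆ S) (m : ℕ) :
    ∃ P : (Fin n → Bool) → ℝ, DegLE m P ∧
      ∀ x : Fin n → Bool, (S.filter (fun i => x i = true)).card ≤ m →
        P x = if S.filter (fun i => x i = true) = W then 1 else 0 := by
  refine ⟨fun x => ∑ U ∈ (S \ W).powerset with (W ∪ U).card ≤ m, (-1) ^ U.card * XS (W ∪ U) x,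
    DegLE.sum _ fun U hU => (DegLE.monomial (Finset.mem_filter.mp hU).2).const_mul _,
    fun x hx => ?_⟩
  have h1 : ∑ U ∈ (S \ W).powerset with (W ∪ U).card ≤ m, (-1) ^ U.card * XS (W ∪ U) x =
      XS W x * ∏ i ∈ S \ W, (1 - b01 (x i)) := by
    rw [Finset.prod_sub, Finset.mul_sum, Finset.sum_filter]
    refine Finset.sum_congr rfl fun U hU => ?_
    have hUS : W ∪ U ⊆ S :=
      Finset.union_subset hW ((Finset.mem_powerset.mp hU).trans Finset.sdiff_subset)
    split_ifs with hcard
    · rw [← XS_mul]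
      simp [XS]
      ring
    · have h0 : XS (W ∪ U) x = 0 := by
        rw [XS_eq_ite, if_neg]
        intro hsub
        refine hcard ((Finset.card_le_card fun i hi => ?_).trans hx)
        exact Finset.mem_filter.mpr ⟨hUS hi, by simpa using hsub hi⟩
      rw [← XS_mul] at h0
      have : XS W x * ∏ i ∈ U, b01 (x i) = 0 := h0
      simp only [Finset.prod_const_one, mul_one]
      linear_combination (-(-1) ^ U.card) * this
  refine h1.trans ?_
  split_ifs with h
  · subst h
    rw [XS_eq_ite, if_pos (Finset.filter_subset_filter _ (Finset.subset_univ S)), one_mul]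
    exact Finset.prod_eq_one fun i hi => by simp_all [b01]
  · by_cases hsub : W ⊆ Finset.univ.filter (fun i => x i = true)
    · obtain ⟨i, hi, hiW⟩ : ∃ i ∈ S.filter (fun i => x i = true), i ∉ W := by
        by_contra! hcon
        exact h (Finset.Subset.antisymm hcon fun i hi =>
          Finset.mem_filter.mpr ⟨hW hi, by simpa using hsub hi⟩)
      rw [Finset.mem_filter] at hi
      rw [Finset.prod_eq_zero (Finset.mem_sdiff.mpr ⟨hi.1, hiW⟩) (by simp [hi.2, b01]), mul_zero]
    · rw [XS_eq_ite, if_neg hsub, zero_mul]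

end LowWeight

section FractionalKnapsack

variable {ι : Type*} [DecidableEq ι] {c v : ι → ℝ}

/-- The greedy prefix and the critical item of a fractional knapsack. -/
lemma exists_greedy_prefix (hc : ∀ i, 0 ≤ c i) (hv : ∀ i, 0 ≤ v i) (B : ℝ) (hB : 0 ≤ B) (F : Finset ι)
    (hF : B < ∑ i ∈ F, c i) :
    ∃ A ⊆ F, ∃ k ∈ F, 0 < c k ∧ ∑ i ∈ A, c i ≤ B ∧ B < ∑ i ∈ A, c i + c k ∧
      (∀ j ∈ A, v k * c j ≤ v j * c k) ∧ ∀ j ∈ F, j ∉ A → v j * c k ≤ v k * c j := by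
  induction F using Finset.strongInduction with
  | H F ih =>
    have hne : (F.filter (fun i => 0 < c i)).Nonempty := by
      by_contra hempty
      rw [Finset.not_nonempty_iff_eq_empty, Finset.filter_eq_empty_iff] at hempty
      exact absurd (Finset.sum_nonpos fun i hi => not_lt.mp (hempty hi)) (by linarith)
    obtain ⟨i, hi, hmin⟩ := Finset.exists_min_image _ (fun i => v i / c i) hne
    obtain ⟨hiF, hci⟩ := Finset.mem_filter.mp hi
    have hdens : ∀ j ∈ F, 0 < c j → v i * c j ≤ v j * c i := fun j hj hcj => by
      simpa [div_le_div_iff₀ hci hcj] using hmin j (Finset.mem_filter.mpr ⟨hj, hcj⟩)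
    have hsplit := Finset.sum_erase_add F c hiF
    by_cases hle : ∑ j ∈ F.erase i, c j ≤ B
    · refine ⟨F.erase i, Finset.erase_subset _ _, i, hiF, hci, hle, by linarith,
        fun j hj => ?_, fun j hj hjA => ?_⟩
      · rcases (hc j).eq_or_lt with h0 | hcj
        · rw [← h0, mul_zero]
          exact mul_nonneg (hv j) hci.le
        · exact hdens j (Finset.mem_of_mem_erase hj) hcj
      · obtain rfl : j = i := by_contra fun hji => hjA (Finset.mem_erase.mpr ⟨hji, hj⟩)
        exact le_rfl
    · obtain ⟨A, hA, k, hk, hck, h1, h2, h3, h4⟩ :=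
        ih _ (Finset.erase_ssubset hiF) (not_le.mp hle)
      refine ⟨A, hA.trans (Finset.erase_subset _ _), k, Finset.mem_of_mem_erase hk, hck, h1, h2,
        h3, fun j hj hjA => ?_⟩
      by_cases hji : j = i
      · subst hji
        exact hdens k (Finset.mem_of_mem_erase hk) hck
      · exact h4 j (Finset.mem_erase.mpr ⟨hji, hj⟩) hjA

/-- A fractional knapsack solution of total mass `p` is beaten by an integral one up to one item. -/
lemma exists_integral_knapsack (hc : ∀ i, 0 ≤ c i) (hv : ∀ i, 0 ≤ v i) {B p M : ℝ} (hB : 0 ≤ B)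
    (hp : 0 ≤ p) (hM : 0 ≤ M) (F : Finset ι) (hvM : ∀ i ∈ F, v i ≤ M) (z : ι → ℝ)
    (hz0 : ∀ i, 0 ≤ z i) (hzp : ∀ i, z i ≤ p) (hcz : ∑ i ∈ F, c i * z i ≤ B * p) :
    ∃ A ⊆ F, ∑ i ∈ A, c i ≤ B ∧ ∑ i ∈ F, v i * z i ≤ (∑ i ∈ A, v i + M) * p := by
  by_cases hF : ∑ i ∈ F, c i ≤ B
  · refine ⟨F, subset_rfl, hF, ?_⟩
    rw [add_mul, Finset.sum_mul]
    have := Finset.sum_le_sum fun i (_ : i ∈ F) => mul_le_mul_of_nonneg_left (hzp i) (hv i)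
    nlinarith
  obtain ⟨A, hA, k, hk, hck, h1, h2, h3, h4⟩ :=
    exists_greedy_prefix hc hv B hB F (not_le.mp hF)
  refine ⟨A, hA, h1, ?_⟩
  set l := v k / c k with hl
  have hlk : l * c k = v k := div_mul_cancel₀ _ hck.ne'
  have hl0 : 0 ≤ l := div_nonneg (hv k) hck.le
  have hin : ∀ j ∈ A, 0 ≤ v j - l * c j := fun j hj => by
    rw [sub_nonneg, hl, div_mul_eq_mul_div, div_le_iff₀ hck]
    exact h3 j hj
  have hout : ∀ j ∈ F, j ∉ A → v j - l * c j ≤ 0 := fun j hj hjA => by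
    rw [sub_nonpos, hl, div_mul_eq_mul_div, le_div_iff₀ hck]
    exact h4 j hj hjA
  have hred : ∑ i ∈ F, (v i - l * c i) * z i ≤ ∑ i ∈ A, (v i - l * c i) * p := by
    rw [← Finset.sum_sdiff hA]
    have ho : ∑ i ∈ F \ A, (v i - l * c i) * z i ≤ 0 := Finset.sum_nonpos fun i hi =>
      mul_nonpos_of_nonpos_of_nonneg
        (hout i (Finset.mem_sdiff.mp hi).1 (Finset.mem_sdiff.mp hi).2) (hz0 i)
    have hi := Finset.sum_le_sum fun i (hi : i ∈ A) =>
      mul_le_mul_of_nonneg_left (hzp i) (hin i hi)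
    linarith
  have e1 : ∑ i ∈ F, (v i - l * c i) * z i = ∑ i ∈ F, v i * z i - l * ∑ i ∈ F, c i * z i := by
    rw [Finset.mul_sum, ← Finset.sum_sub_distrib]
    exact Finset.sum_congr rfl fun i _ => by ring
  have e2 : ∑ i ∈ A, (v i - l * c i) * p = (∑ i ∈ A, v i - l * ∑ i ∈ A, c i) * p := by
    rw [Finset.mul_sum, ← Finset.sum_sub_distrib, Finset.sum_mul]
  have b1 : l * ∑ i ∈ F, c i * z i ≤ l * (B * p) := mul_le_mul_of_nonneg_left hcz hl0
  have b2 : l * (B - ∑ i ∈ A, c i) ≤ M := by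
    have := mul_le_mul_of_nonneg_left (show B - ∑ i ∈ A, c i ≤ c k by linarith) hl0
    linarith [hvM k hk]
  have b3 := mul_le_mul_of_nonneg_right b2 hp
  nlinarith

end FractionalKnapsack

section Knapsack

variable {n t : ℕ} {c : Fin n → ℝ} {C : ℝ} {D : (Fin n → Bool) → ℝ}

lemma PE_XS_eq_zero_of_infeasible (hc : ∀ i, 0 ≤ c i)
    (hdeg : ∀ f : (Fin n → Bool) → ℝ, DegLE t f → 0 ≤ PE D (fun x => f x * f x))
    (hcon : ∀ f : (Fin n → Bool) → ℝ, DegLE (t - 1) f →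
      0 ≤ PE D (fun x => (C - ∑ i, c i * b01 (x i)) * (f x * f x)))
    {T : Finset (Fin n)} (hT : T.card + 1 ≤ t) (hTC : C < ∑ i ∈ T, c i) :
    PE D (XS T) = 0 := by
  have h := hcon _ (DegLE.monomial (T := T) (by omega))
  have e : (fun x => (C - ∑ i, c i * b01 (x i)) * (XS T x * XS T x)) =
      fun x => C * XS T x - ∑ i, c i * XS (T ∪ {i}) x := by
    funext x
    rw [XS_mul_self, sub_mul, Finset.sum_mul]
    refine congrArg _ (Finset.sum_congr rfl fun i _ => ?_)
    rw [← XS_mul, XS_singleton]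
    ring
  rw [e, PE_sub, PE_const_mul, PE_sum] at h
  simp only [PE_const_mul] at h
  have hT0 := PE_XS_nonneg hdeg (T := T) (by omega)
  have hsub : ∑ i ∈ T, c i * PE D (XS T) ≤ ∑ i, c i * PE D (XS (T ∪ {i})) := by
    calc ∑ i ∈ T, c i * PE D (XS T) = ∑ i ∈ T, c i * PE D (XS (T ∪ {i})) :=
          Finset.sum_congr rfl fun i hi => by
            rw [Finset.union_eq_left.mpr (Finset.singleton_subset_iff.mpr hi)]
      _ ≤ _ := Finset.sum_le_sum_of_subset_of_nonneg (Finset.subset_univ T) fun i _ _ =>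
          mul_nonneg (hc i) (PE_XS_nonneg hdeg (by
            have := Finset.card_union_le T {i}
            rw [Finset.card_singleton] at this
            omega))
  rw [← Finset.sum_mul] at hsub
  nlinarith

lemma PE_XS_eq_zero_of_high_weight (ht : 2 ≤ t) (hc : ∀ i, 0 ≤ c i)
    (hdeg : ∀ f : (Fin n → Bool) → ℝ, DegLE t f → 0 ≤ PE D (fun x => f x * f x))
    (hcon : ∀ f : (Fin n → Bool) → ℝ, DegLE (t - 1) f →
      0 ≤ PE D (fun x => (C - ∑ i, c i * b01 (x i)) * (f x * f x)))
    {S : Finset (Fin n)} (hS : ∀ T ⊆ S, T.card = t - 1 → C < ∑ i ∈ T, c i)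
    {U : Finset (Fin n)} (hU : U.card ≤ 2 * t - 1) (hSU : t - 2 < (S ∩ U).card) :
    PE D (XS U) = 0 := by
  obtain ⟨T, hTSU, hT⟩ := Finset.exists_subset_card_eq (show t - 1 ≤ (S ∩ U).card by omega)
  have hTU : T ⊆ U := hTSU.trans Finset.inter_subset_right
  rw [← Finset.union_sdiff_of_subset hTU]
  refine PE_XS_union_eq_zero hdeg (by omega) (by rw [Finset.card_sdiff_of_subset hTU]; omega) ?_
  exact PE_XS_eq_zero_of_infeasible hc hdeg hcon (by omega)
    (hS T (hTSU.trans Finset.inter_subset_left) hT)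

/-- The value of a pseudo-distribution conditioned on the set `W` of large items chosen. -/
lemma PE_value_le_of_conditioned (ht : 2 ≤ t) {v : Fin n → ℝ} (hc : ∀ i, 0 ≤ c i)
    (hv : ∀ i, 0 ≤ v i) {OPT M : ℝ}
    (hopt : ∀ A : Finset (Fin n), ∑ i ∈ A, c i ≤ C → ∑ i ∈ A, v i ≤ OPT)
    (hdeg : ∀ f : (Fin n → Bool) → ℝ, DegLE t f → 0 ≤ PE D (fun x => f x * f x))
    (hcon : ∀ f : (Fin n → Bool) → ℝ, DegLE (t - 1) f →
      0 ≤ PE D (fun x => (C - ∑ i, c i * b01 (x i)) * (f x * f x)))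
    (hM : 0 ≤ M) {S W : Finset (Fin n)} (hWS : W ⊆ S) (hSM : ∀ i ∉ S, v i ≤ M)
    (hnull : ∀ U : Finset (Fin n), U.card ≤ 2 * t - 1 → t - 2 < (S ∩ U).card → PE D (XS U) = 0)
    {P : (Fin n → Bool) → ℝ} (hP : DegLE (t - 2) P)
    (hPx : ∀ x : Fin n → Bool, (S.filter (fun i => x i = true)).card ≤ t - 2 →
      P x = if S.filter (fun i => x i = true) = W then 1 else 0) :
    PE D (fun x => P x * P x * ∑ i, v i * b01 (x i)) ≤ (OPT + M) * PE D (fun x => P x * P x) := by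
  set p := PE D (fun x => P x * P x) with hp
  set z : Fin n → ℝ := fun i => PE D (fun x => P x * P x * b01 (x i)) with hz
  have hb : ∀ b : Bool, b01 b * b01 b = b01 b := fun b => by cases b <;> simp [b01]
  have hp0 : 0 ≤ p := hdeg _ (hP.mono (by omega))
  have hPi : ∀ i, DegLE t (fun x => P x * b01 (x i)) := fun i =>
    (hP.mul (DegLE.coordinate i)).mono (by omega)
  have hPPi : ∀ i, DegLE (2 * t - 1) (fun x => P x * P x * b01 (x i)) := fun i =>
    ((hP.mul hP).mul (DegLE.coordinate i)).mono (by omega)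
  have hz0 : ∀ i, 0 ≤ z i := fun i => by
    convert hdeg _ (hPi i) using 3 with x
    linear_combination (-(P x * P x)) * hb (x i)
  have hzp : ∀ i, z i ≤ p := fun i => by
    rw [← sub_nonneg, hp, hz, ← PE_sub]
    convert hdeg _ ((hP.mono (by omega)).sub (hPi i)) using 3 with x
    linear_combination (-(P x * P x)) * hb (x i)
  have hlin : ∀ w : Fin n → ℝ,
      PE D (fun x => P x * P x * ∑ i, w i * b01 (x i)) = ∑ i, w i * z i := fun w => by
    simp only [hz, ← PE_const_mul, ← PE_sum]
    congr 1
    funext x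
    rw [Finset.mul_sum]
    exact Finset.sum_congr rfl fun i _ => by ring
  have hcz : ∑ i, c i * z i ≤ C * p := by
    have h := hcon _ (hP.mono (by omega))
    have e : (fun x => (C - ∑ i, c i * b01 (x i)) * (P x * P x)) =
        fun x => C * (P x * P x) - P x * P x * ∑ i, c i * b01 (x i) := by
      funext x
      ring
    rw [e, PE_sub, PE_const_mul, hlin] at h
    linarith
  have hzW : ∀ i ∈ W, z i = p := fun i hi => by
    refine PE_congr_of_low_weight hnull (hPPi i) ((hP.mul hP).mono (by omega)) fun x hx => ?_
    rw [hPx x hx]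
    split_ifs with h
    · have : x i = true := by
        rw [← h] at hi
        exact (Finset.mem_filter.mp hi).2
      simp [this, b01]
    · simp
  have hzS : ∀ i ∈ S, i ∉ W → z i = 0 := fun i hiS hiW => by
    have h0 : PE D (fun _ => 0) = 0 := by simp [PE]
    rw [← h0]
    refine PE_congr_of_low_weight hnull (hPPi i)
      (by simpa using (DegLE.one (n := n) (d := 2 * t - 1)).const_mul 0) fun x hx => ?_
    rw [hPx x hx]
    split_ifs with h
    · have : x i = false := by
        by_contra hxi
        exact hiW (h ▸ Finset.mem_filter.mpr ⟨hiS, by simpa using hxi⟩)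
      simp [this, b01]
    · simp
  have hsplit : ∀ w : Fin n → ℝ,
      ∑ i, w i * z i = (∑ i ∈ W, w i) * p + ∑ i ∈ Sᶜ, w i * z i := fun w => by
    rw [← Finset.sum_add_sum_compl S, ← Finset.sum_sdiff hWS,
      Finset.sum_eq_zero (s := S \ W) fun i hi => by
        rw [hzS i (Finset.mem_sdiff.mp hi).1 (Finset.mem_sdiff.mp hi).2, mul_zero],
      Finset.sum_congr rfl fun i hi => by rw [hzW i hi], zero_add, Finset.sum_mul]
  rw [hlin, hsplit]
  rw [hsplit] at hcz
  rcases hp0.eq_or_lt with hp0' | hpos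
  · have hz' : ∀ i, z i = 0 := fun i => le_antisymm (hp0' ▸ hzp i) (hz0 i)
    simp [hz', ← hp0']
  have hout : 0 ≤ ∑ i ∈ Sᶜ, c i * z i := Finset.sum_nonneg fun i _ => mul_nonneg (hc i) (hz0 i)
  have hWC : ∑ i ∈ W, c i ≤ C := le_of_mul_le_mul_right (by linarith) hpos
  obtain ⟨A, hA, hAC, hAv⟩ := exists_integral_knapsack hc hv (sub_nonneg.mpr hWC) hp0 hM Sᶜ
    (fun i hi => hSM i (Finset.mem_compl.mp hi)) z hz0 hzp (by linarith)
  have hdisj : Disjoint W A :=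
    Finset.disjoint_of_subset_left hWS (Finset.disjoint_of_subset_right hA disjoint_compl_right)
  have hWA := hopt (W ∪ A) (by rw [Finset.sum_union hdisj]; linarith)
  rw [Finset.sum_union hdisj] at hWA
  nlinarith

end Knapsack

/-- Main theorem: for a knapsack instance with integer optimum
`OPT` and any `t ≥ 2`, every pseudo-distribution of degree at least `2t` on
`{0,1}^n` satisfying the constraint `∑ c_i x_i ≤ C` has
`Ẽ_D[∑ v_i x_i] ≤ (1 + 1/(t-1))·OPT`. -/
theorem sos_knapsack_integrality_gap (n t : ℕ) (ht : 2 ≤ t)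
    (c v : Fin n → ℝ) (hc : ∀ i, 0 ≤ c i) (hv : ∀ i, 0 ≤ v i)
    (C : ℝ) (hC : 0 ≤ C) (OPT : ℝ)
    (hOPT : IsGreatest {s : ℝ | ∃ x : Fin n → Bool,
      (∑ i, c i * b01 (x i)) ≤ C ∧ s = ∑ i, v i * b01 (x i)} OPT)
    (D : (Fin n → Bool) → ℝ) (hsum : ∑ x, D x = 1)
    (hdeg : ∀ f : (Fin n → Bool) → ℝ, DegLE t f → 0 ≤ PE D (fun x => f x * f x))
    (hcon : ∀ f : (Fin n → Bool) → ℝ, DegLE (t - 1) f →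
      0 ≤ PE D (fun x => (C - ∑ i, c i * b01 (x i)) * (f x * f x))) :
    PE D (fun x => ∑ i, v i * b01 (x i)) ≤ (1 + 1 / ((t : ℝ) - 1)) * OPT := by
  have hopt : ∀ A : Finset (Fin n), ∑ i ∈ A, c i ≤ C → ∑ i ∈ A, v i ≤ OPT := fun A hA => by
    have hind : ∀ w : Fin n → ℝ, ∑ i, w i * b01 (decide (i ∈ A)) = ∑ i ∈ A, w i := fun w => by
      simp [b01]
    exact hOPT.2 ⟨fun i => decide (i ∈ A), by rwa [hind], (hind v).symm⟩
  have hO : 0 ≤ OPT := by simpa using hopt ∅ (by simpa using hC)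
  have ht1 : (0 : ℝ) < (t : ℝ) - 1 := by
    have : (2 : ℝ) ≤ t := by exact_mod_cast ht
    linarith
  set M : ℝ := OPT / ((t : ℝ) - 1) with hMdef
  have hM : 0 ≤ M := div_nonneg hO ht1.le
  set S : Finset (Fin n) := Finset.univ.filter (fun i => M < v i) with hSdef
  have hSM : ∀ i ∉ S, v i ≤ M := fun i hi => by simpa [hSdef] using hi
  have hS : ∀ T ⊆ S, T.card = t - 1 → C < ∑ i ∈ T, c i := fun T hTS hT => by
    by_contra hle
    have hTO := hopt T (not_lt.mp hle)
    have hlt : ∑ _i ∈ T, M < ∑ i ∈ T, v i := Finset.sum_lt_sum_of_nonempty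
      (Finset.card_pos.mp (by omega)) fun i hi => (Finset.mem_filter.mp (hTS hi)).2
    rw [Finset.sum_const, hT, nsmul_eq_mul, Nat.cast_sub (by omega), Nat.cast_one,
      mul_div_cancel₀ _ ht1.ne'] at hlt
    linarith
  have hnull : ∀ U : Finset (Fin n), U.card ≤ 2 * t - 1 → t - 2 < (S ∩ U).card →
      PE D (XS U) = 0 := fun U => PE_XS_eq_zero_of_high_weight ht hc hdeg hcon hS
  choose! P hP hPx using fun (W : Finset (Fin n)) (hW : W ⊆ S) =>
    exists_low_degree_indicator hW (t - 2)
  have hone : ∀ x : Fin n → Bool, (S.filter (fun i => x i = true)).card ≤ t - 2 →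
      ∑ W ∈ S.powerset, P W x * P W x = 1 := fun x hx => by
    rw [Finset.sum_eq_single (S.filter (fun i => x i = true))]
    · simp [hPx _ (Finset.filter_subset _ S) x hx]
    · intro W hW hne
      simp [hPx W (Finset.mem_powerset.mp hW) x hx, hne.symm]
    · intro h
      exact absurd (Finset.mem_powerset.mpr (Finset.filter_subset _ S)) h
  have hval : DegLE 1 (fun x : Fin n → Bool => ∑ i, v i * b01 (x i)) :=
    DegLE.sum _ fun i _ => (DegLE.coordinate i).const_mul _
  have hPP : ∀ W ∈ S.powerset, DegLE (2 * t - 2) (fun x => P W x * P W x) := fun W hW =>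
    ((hP W (Finset.mem_powerset.mp hW)).mul (hP W (Finset.mem_powerset.mp hW))).mono (by omega)
  have hmass : ∑ W ∈ S.powerset, PE D (fun x => P W x * P W x) = 1 := by
    rw [← PE_sum, PE_congr_of_low_weight (g := fun _ => 1) hnull
      ((DegLE.sum _ hPP).mono (by omega)) DegLE.one hone]
    simpa [PE] using hsum
  have hdecomp : PE D (fun x => ∑ i, v i * b01 (x i)) =
      ∑ W ∈ S.powerset, PE D (fun x => P W x * P W x * ∑ i, v i * b01 (x i)) := by
    rw [← PE_sum]
    refine PE_congr_of_low_weight hnull (hval.mono (by omega))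
      (DegLE.sum _ fun W hW => ((hPP W hW).mul hval).mono (by omega)) fun x hx => ?_
    rw [← Finset.sum_mul, hone x hx, one_mul]
  calc PE D (fun x => ∑ i, v i * b01 (x i))
      ≤ ∑ W ∈ S.powerset, (OPT + M) * PE D (fun x => P W x * P W x) := by
        rw [hdecomp]
        refine Finset.sum_le_sum fun W hW => ?_
        have hWS := Finset.mem_powerset.mp hW
        exact PE_value_le_of_conditioned ht hc hv hopt hdeg hcon hM hWS hSM hnull
          (hP W hWS) (hPx W hWS)
    _ = (1 + 1 / ((t : ℝ) - 1)) * OPT := by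
        rw [← Finset.mul_sum, hmass, hMdef]
        ring
end
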